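/- Let ε be an edge-weight function on a finite set V with n = |V|, let V' be a finite set with |V'| = n − k, and let q : V → V' be a surjection. Define quotient edge weights on V' by ε_q(x,y) = ∑_{u : q(u) = x} ∑_{v : q(v) = y} ε(u,v) for x ≠ y, with ε_q(x,x) = 0, and let p be the number of points x ∈ V' whose fibre q^{-1}(x) has more than one element. Let λ_1 ≤ … ≤ λ_n and μ_1 ≤ … ≤ μ_{n−k} denote the eigenvalues, counted with multiplicity and in nondecreasing order, of the combinatorial Laplacians L(ε) and L(ε_q), respectively. Then for all 1 ≤ i ≤ n−k: λ_i ≤ μ_i, and μ_i ≤ λ_{i+p+k} whenever i+p+k ≤ n. -/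

import Mathlib

open Matrix Polynomial
open scoped Classical

/-- The combinatorial Laplacian of an edge-weight function. -/
noncomputable def lapMat {V : Type} [Fintype V] [DecidableEq V] (ε : V → V → ℝ) :
    Matrix V V ℝ :=
  Matrix.diagonal (fun v => ∑ u, ε v u) - Matrix.of ε

theorem roots_fintype_prod_X_sub_C {ι : Type*} [Fintype ι] (f : ι → ℝ) :
    (∏ i, (X - C (f i))).roots = Finset.univ.val.map f := by
  rw [← roots_multiset_prod_X_sub_C (Finset.univ.val.map f), Multiset.map_map]
  rfl

theorem exists_equiv_of_prod_X_sub_C_eq {ι κ : Type*} [Fintype ι] [Fintype κ]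
    {f : ι → ℝ} {g : κ → ℝ} (h : ∏ i, (X - C (f i)) = ∏ j, (X - C (g j))) :
    ∃ e : ι ≃ κ, ∀ i, g (e i) = f i := by
  have hfg : Finset.univ.val.map f = Finset.univ.val.map g := by
    rw [← roots_fintype_prod_X_sub_C, ← roots_fintype_prod_X_sub_C, h]
  have hcard : ∀ c, Nonempty ({i // f i = c} ≃ {j // g j = c}) := fun c => by
    rw [← Fintype.card_eq, Fintype.card_subtype, Fintype.card_subtype]
    have := congrArg (Multiset.count c) hfg
    simpa [Multiset.count_map, Finset.card_def, eq_comm] using this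
  exact ⟨Equiv.ofFiberEquiv fun c => (hcard c).some, Equiv.ofFiberEquiv_map _⟩

theorem Matrix.IsHermitian.exists_coordinates {V ι : Type*} [Fintype V] [DecidableEq V] [Fintype ι]
    {A : Matrix V V ℝ} (hA : A.IsHermitian) {lam : ι → ℝ}
    (hlam : A.charpoly = ∏ i, (X - C (lam i))) :
    ∃ T : (V → ℝ) →ₗ[ℝ] (ι → ℝ), (∀ x, x ⬝ᵥ x = ∑ i, T x i ^ 2) ∧
      ∀ x, x ⬝ᵥ A *ᵥ x = ∑ i, lam i * T x i ^ 2 := by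
  obtain ⟨e, he⟩ := exists_equiv_of_prod_X_sub_C_eq (hlam.symm.trans hA.charpoly_eq)
  set U : Matrix V V ℝ := hA.eigenvectorUnitary.1
  have hUU : U * Uᵀ = 1 := by
    have := (Matrix.mem_unitaryGroup_iff (A := U)).1 hA.eigenvectorUnitary.2
    simpa [star_eq_conjTranspose, conjTranspose_eq_transpose_of_trivial] using this
  have hAU : A = U * diagonal hA.eigenvalues * Uᵀ := by
    have := hA.spectral_theorem
    rw [Unitary.conjStarAlgAut_apply] at this
    simpa [star_eq_conjTranspose, conjTranspose_eq_transpose_of_trivial, Function.comp_def]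
      using this
  refine ⟨(LinearMap.funLeft ℝ ℝ e).comp (Matrix.mulVecLin Uᵀ), fun x => ?_, fun x => ?_⟩
  · have h1 : x ⬝ᵥ x = (Uᵀ *ᵥ x) ⬝ᵥ (Uᵀ *ᵥ x) := by
      rw [dotProduct_mulVec, vecMul_transpose, mulVec_mulVec, hUU, one_mulVec]
    rw [h1, dotProduct, ← e.sum_comp]
    simp [LinearMap.funLeft, mulVec_transpose, sq]
  · have h1 : x ⬝ᵥ A *ᵥ x = (Uᵀ *ᵥ x) ⬝ᵥ (diagonal hA.eigenvalues *ᵥ (Uᵀ *ᵥ x)) := by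
      conv_lhs => rw [hAU]
      rw [← mulVec_mulVec, ← mulVec_mulVec, dotProduct_mulVec x U, ← mulVec_transpose]
    rw [h1, dotProduct, ← e.sum_comp]
    refine Finset.sum_congr rfl fun i _ => ?_
    simp [LinearMap.funLeft, mulVec_diagonal, mulVec_transpose, ← he]
    ring

theorem exists_ne_zero_forall_eq_zero {E ι : Type*} [AddCommGroup E] [Module ℝ E]
    [FiniteDimensional ℝ E] [Fintype ι] (φ : ι → E →ₗ[ℝ] ℝ)
    (h : Fintype.card ι < Module.finrank ℝ E) : ∃ x ≠ 0, ∀ i, φ i x = 0 := by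
  have hker : LinearMap.ker (LinearMap.pi φ) ≠ ⊥ :=
    LinearMap.ker_ne_bot_of_finrank_lt (by simpa using h)
  obtain ⟨x, hx, hx0⟩ := Submodule.exists_mem_ne_zero_of_ne_bot hker
  exact ⟨x, hx0, fun i => congrFun (LinearMap.mem_ker.1 hx) i⟩

theorem lapMat_isHermitian {V : Type} [Fintype V] [DecidableEq V]
    {ε : V → V → ℝ} (hsym : ∀ u v, ε u v = ε v u) :
    (lapMat ε).IsHermitian := by
  refine (isHermitian_diagonal _).sub ?_
  ext u v
  simp [hsym v u]

theorem dotProduct_lapMat_mulVec {V : Type} [Fintype V] [DecidableEq V]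
    (ε : V → V → ℝ) (x : V → ℝ) :
    x ⬝ᵥ lapMat ε *ᵥ x = ∑ u, ∑ v, ε u v * (x u ^ 2 - x u * x v) := by
  refine Finset.sum_congr rfl fun u _ => ?_
  simp only [lapMat, sub_mulVec, Pi.sub_apply, mulVec_diagonal, mul_sub, Finset.sum_sub_distrib]
  congr 1
  · rw [← Finset.sum_mul]; ring
  · rw [mulVec, dotProduct, Finset.mul_sum]
    exact Finset.sum_congr rfl fun v _ => by simp only [of_apply]; ring

theorem dotProduct_lapMat_mulVec_nonneg {V : Type} [Fintype V] [DecidableEq V]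
    {ε : V → V → ℝ} (hsym : ∀ u v, ε u v = ε v u)
    (hnonneg : ∀ u v, 0 ≤ ε u v) (x : V → ℝ) : 0 ≤ x ⬝ᵥ lapMat ε *ᵥ x := by
  have h2 : 2 * (x ⬝ᵥ lapMat ε *ᵥ x) = ∑ u, ∑ v, ε u v * (x u - x v) ^ 2 := by
    have hswap : x ⬝ᵥ lapMat ε *ᵥ x = ∑ u, ∑ v, ε u v * (x v ^ 2 - x v * x u) := by
      rw [dotProduct_lapMat_mulVec, Finset.sum_comm]
      simp only [fun u v => hsym v u]
    rw [two_mul]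
    nth_rewrite 1 [dotProduct_lapMat_mulVec]
    rw [hswap]
    simp only [← Finset.sum_add_distrib]
    exact Finset.sum_congr rfl fun u _ => Finset.sum_congr rfl fun v _ => by ring
  have : 0 ≤ ∑ u, ∑ v, ε u v * (x u - x v) ^ 2 :=
    Finset.sum_nonneg fun u _ => Finset.sum_nonneg fun v _ =>
      mul_nonneg (hnonneg u v) (sq_nonneg _)
  linarith

/-- The quotient of an edge-weight function along a map of vertex sets. -/
noncomputable def quotientWeight {V V' : Type} [Fintype V] [DecidableEq V']
    (ε : V → V → ℝ) (q : V → V') (x y : V') : ℝ :=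
  if x = y then 0 else
    ∑ u ∈ Finset.univ.filter (fun u => q u = x), ∑ v ∈ Finset.univ.filter (fun v => q v = y), ε u v

theorem quotientWeight_symm {V V' : Type} [Fintype V] [DecidableEq V']
    {ε : V → V → ℝ} (hsym : ∀ u v, ε u v = ε v u) (q : V → V')
    (x y : V') : quotientWeight ε q x y = quotientWeight ε q y x := by
  simp only [quotientWeight, eq_comm (a := y)]
  split_ifs
  · rfl
  · rw [Finset.sum_comm]
    simp only [fun u v => hsym v u]

theorem dotProduct_lapMat_quotientWeight_mulVec {V V' : Type} [Fintype V] [DecidableEq V]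
    [Fintype V'] [DecidableEq V']
    (ε : V → V → ℝ) (q : V → V') (g : V' → ℝ) :
    g ⬝ᵥ lapMat (quotientWeight ε q) *ᵥ g = (g ∘ q) ⬝ᵥ lapMat ε *ᵥ (g ∘ q) := by
  rw [dotProduct_lapMat_mulVec, dotProduct_lapMat_mulVec, ← Finset.sum_fiberwise _ q]
  refine Finset.sum_congr rfl fun x _ => ?_
  simp_rw [← Finset.sum_fiberwise Finset.univ q (fun v => ε _ v * _)]
  rw [Finset.sum_comm]
  refine Finset.sum_congr rfl fun y _ => ?_
  have h : ∀ u ∈ Finset.univ.filter (fun u => q u = x),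
      ∑ v ∈ Finset.univ.filter (fun v => q v = y),
        ε u v * ((g ∘ q) u ^ 2 - (g ∘ q) u * (g ∘ q) v) =
      (∑ v ∈ Finset.univ.filter (fun v => q v = y), ε u v) * (g x ^ 2 - g x * g y) := by
    intro u hu
    rw [Finset.sum_mul]
    refine Finset.sum_congr rfl fun v hv => ?_
    simp [(Finset.mem_filter.1 hu).2, (Finset.mem_filter.1 hv).2]
  rw [Finset.sum_congr rfl h, ← Finset.sum_mul, quotientWeight]
  split_ifs with hxy
  · subst hxy; ring
  · rfl

theorem dotProduct_comp_self {V V' : Type} [Fintype V] [Fintype V'] [DecidableEq V']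
    (q : V → V') (g : V' → ℝ) :
    (g ∘ q) ⬝ᵥ (g ∘ q) = ∑ x, ((Finset.univ.filter fun v => q v = x).card : ℝ) * g x ^ 2 := by
  rw [dotProduct, ← Finset.sum_fiberwise _ q]
  refine Finset.sum_congr rfl fun x _ => ?_
  rw [← nsmul_eq_mul, ← Finset.sum_const]
  exact Finset.sum_congr rfl fun v hv => by simp [(Finset.mem_filter.1 hv).2, sq]

theorem card_fiber_pos {V V' : Type} [Fintype V] [DecidableEq V']
    {q : V → V'} (hq : Function.Surjective q) (x : V') :
    0 < (Finset.univ.filter fun v => q v = x).card := by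
  obtain ⟨v, hv⟩ := hq x
  exact Finset.card_pos.2 ⟨v, by simp [hv]⟩

theorem dotProduct_self_le_comp {V V' : Type} [Fintype V] [Fintype V'] [DecidableEq V']
    {q : V → V'} (hq : Function.Surjective q) (g : V' → ℝ) :
    g ⬝ᵥ g ≤ (g ∘ q) ⬝ᵥ (g ∘ q) := by
  rw [dotProduct_comp_self]
  refine Finset.sum_le_sum fun x _ => ?_
  have : (1 : ℝ) ≤ (Finset.univ.filter fun v => q v = x).card := by
    exact_mod_cast card_fiber_pos hq x
  nlinarith [sq_nonneg (g x)]

theorem dotProduct_comp_self_of_eq_zero {V V' : Type} [Fintype V] [Fintype V'] [DecidableEq V']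
    {q : V → V'} (hq : Function.Surjective q) {g : V' → ℝ}
    (hg : ∀ x, 1 < (Finset.univ.filter fun v => q v = x).card → g x = 0) :
    (g ∘ q) ⬝ᵥ (g ∘ q) = g ⬝ᵥ g := by
  rw [dotProduct_comp_self]
  refine Finset.sum_congr rfl fun x _ => ?_
  rcases (Nat.succ_le_of_lt (card_fiber_pos hq x)).lt_or_eq with h | h
  · simp [hg x h]
  · rw [← h]; simp [sq]

theorem sum_mul_sq_le {ι : Type*} [Fintype ι] {lam t : ι → ℝ} {c : ℝ}
    (h : ∀ i, c < lam i → t i = 0) : ∑ i, lam i * t i ^ 2 ≤ c * ∑ i, t i ^ 2 := by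
  rw [Finset.mul_sum]
  refine Finset.sum_le_sum fun i _ => ?_
  rcases le_or_gt (lam i) c with hi | hi
  · exact mul_le_mul_of_nonneg_right hi (sq_nonneg _)
  · simp [h i hi]

theorem le_sum_mul_sq {ι : Type*} [Fintype ι] {lam t : ι → ℝ} {c : ℝ}
    (h : ∀ i, lam i < c → t i = 0) : c * ∑ i, t i ^ 2 ≤ ∑ i, lam i * t i ^ 2 := by
  rw [Finset.mul_sum]
  refine Finset.sum_le_sum fun i _ => ?_
  rcases le_or_gt c (lam i) with hi | hi
  · exact mul_le_mul_of_nonneg_right hi (sq_nonneg _)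
  · simp [h i hi]

/-- **Combinatorial Laplacian quotient interlacing**: for a quotient of an edge-weighted
graph, `λᵢ ≤ μᵢ` and `μᵢ ≤ λ_{i+p+k}` whenever `i + p + k ≤ n`, where `p` is the number
of fibres with more than one element. -/
theorem interlacing_combinatorial_quotient
    {V V' : Type} [Fintype V] [DecidableEq V] [Fintype V'] [DecidableEq V']
    (ε : V → V → ℝ) (hsym : ∀ u v, ε u v = ε v u)
    (hnonneg : ∀ u v, 0 ≤ ε u v) (hdiag : ∀ v, ε v v = 0)
    (n k : ℕ) (hn : n = Fintype.card V) (hcard : Fintype.card V' + k = n)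
    (q : V → V') (hq : Function.Surjective q)
    (εq : V' → V' → ℝ)
    (hεq : εq = fun x y => if x = y then 0 else
      ∑ u ∈ Finset.univ.filter (fun u => q u = x),
        ∑ v ∈ Finset.univ.filter (fun v => q v = y), ε u v)
    (p : ℕ)
    (hp : p = (Finset.univ.filter
      (fun x : V' => 1 < (Finset.univ.filter (fun v => q v = x)).card)).card)
    (lam : Fin n → ℝ) (hlamMono : Monotone lam)
    (hlam : (lapMat ε).charpoly = ∏ i, (X - C (lam i)))
    (mu : Fin (n - k) → ℝ) (hmuMono : Monotone mu)
    (hmu : (lapMat εq).charpoly = ∏ i, (X - C (mu i))) :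
    ∀ i : Fin (n - k),
      lam ⟨(i : ℕ), by have := i.2; omega⟩ ≤ mu i ∧
      ∀ h : (i : ℕ) + p + k < n, mu i ≤ lam ⟨(i : ℕ) + p + k, h⟩ := by
  obtain rfl : εq = quotientWeight ε q := hεq
  obtain ⟨T, hT, hTA⟩ := (lapMat_isHermitian hsym).exists_coordinates hlam
  obtain ⟨S, hS, hSA⟩ :=
    (lapMat_isHermitian (quotientWeight_symm hsym q)).exists_coordinates hmu
  have pos : ∀ {g : V' → ℝ}, g ≠ 0 → 0 < g ⬝ᵥ g := fun hg =>
    lt_of_le_of_ne (Finset.sum_nonneg fun _ _ => mul_self_nonneg _)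
      (Ne.symm (mt dotProduct_self_eq_zero.1 hg))
  let P : (V' → ℝ) →ₗ[ℝ] (V → ℝ) := LinearMap.funLeft ℝ ℝ q
  intro i
  refine ⟨?_, fun h => ?_⟩
  · have hi : (i : ℕ) < n := by omega
    obtain ⟨g, hg0, hg⟩ := exists_ne_zero_forall_eq_zero
      (Sum.elim (fun j : Finset.Ioi i => (LinearMap.proj j.1).comp S)
        (fun j : Finset.Iio (⟨i, hi⟩ : Fin n) => (LinearMap.proj j.1).comp (T.comp P)))
      (by
        rw [Fintype.card_sum, Fintype.card_coe, Fintype.card_coe, Fin.card_Iio, Fin.card_Ioi,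
          Module.finrank_fintype_fun_eq_card]
        dsimp only
        omega)
    have hSg : ∀ j, mu i < mu j → S g j = 0 := fun j hj =>
      hg (.inl ⟨j, Finset.mem_Ioi.2 (hmuMono.reflect_lt hj)⟩)
    have hTg : ∀ j, lam j < lam ⟨i, hi⟩ → T (g ∘ q) j = 0 := fun j hj =>
      hg (.inr ⟨j, Finset.mem_Iio.2 (hlamMono.reflect_lt hj)⟩)
    have h1 := sum_mul_sq_le hSg
    have h2 := le_sum_mul_sq hTg
    rw [← hS, ← hSA, dotProduct_lapMat_quotientWeight_mulVec] at h1
    rw [← hT, ← hTA] at h2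
    have h3 := dotProduct_lapMat_mulVec_nonneg hsym hnonneg (g ∘ q)
    have h4 := dotProduct_self_le_comp hq g
    have h5 := pos hg0
    have h6 : 0 ≤ mu i := nonneg_of_mul_nonneg_left (h3.trans h1) h5
    exact le_of_mul_le_mul_right
      (h2.trans (h1.trans (mul_le_mul_of_nonneg_left h4 h6))) (h5.trans_le h4)
  · obtain ⟨g, hg0, hg⟩ := exists_ne_zero_forall_eq_zero
      (Sum.elim (fun j : Finset.Iio i => (LinearMap.proj j.1).comp S)
        (Sum.elim
          (fun j : Finset.Ioi (⟨i + p + k, h⟩ : Fin n) => (LinearMap.proj j.1).comp (T.comp P))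
          (fun x : Finset.univ.filter
            (fun x : V' => 1 < (Finset.univ.filter (fun v => q v = x)).card) =>
              (LinearMap.proj x.1 : (V' → ℝ) →ₗ[ℝ] ℝ))))
      (by
        rw [Fintype.card_sum, Fintype.card_sum, Fintype.card_coe, Fintype.card_coe,
          Fintype.card_coe, ← hp, Fin.card_Iio, Fin.card_Ioi, Module.finrank_fintype_fun_eq_card]
        dsimp only
        omega)
    have hSg : ∀ j, mu j < mu i → S g j = 0 := fun j hj =>
      hg (.inl ⟨j, Finset.mem_Iio.2 (hmuMono.reflect_lt hj)⟩)
    have hTg : ∀ j, lam ⟨i + p + k, h⟩ < lam j → T (g ∘ q) j = 0 := fun j hj =>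
      hg (.inr (.inl ⟨j, Finset.mem_Ioi.2 (hlamMono.reflect_lt hj)⟩))
    have hgx : ∀ x, 1 < (Finset.univ.filter fun v => q v = x).card → g x = 0 := fun x hx =>
      hg (.inr (.inr ⟨x, by simpa using hx⟩))
    have h1 := le_sum_mul_sq hSg
    have h2 := sum_mul_sq_le hTg
    rw [← hS, ← hSA, dotProduct_lapMat_quotientWeight_mulVec] at h1
    rw [← hT, ← hTA, dotProduct_comp_self_of_eq_zero hq hgx] at h2
    exact le_of_mul_le_mul_right (h1.trans h2) (pos hg0)
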